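/- arXiv:1805.10075 — 2 statements merged into one kernel-verified Lean document; each statement's English description precedes it below -/
import Mathlib

section
/- Fix A > 0 and α > 0. For every a ≥ 1, the eigenvalue of the rectangle with side lengths √A·a and √A/a associated with the (2,1) mode satisfies λ₂(√A·a, α) + λ₁(√A/a, α) > 2·λ₁(√(A/2), α). (Consequently, the second Robin eigenvalue of any rectangle of area A is strictly larger than the second Robin eigenvalue of the disjoint union of two equal squares of total area A.) -/
open Real

/-- `x ↦ x tan x` is strictly increasing on `(0, π/2)`; stated in inverse form. -/
lemma lt_of_mul_tan_lt_mul_tan {x y : ℝ} (hy0 : 0 < y) (hx : x < π / 2)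
    (hy : y < π / 2) (h : x * tan x < y * tan y) : x < y := by
  by_contra! hyx
  have h1 : tan y ≤ tan x :=
    Real.strictMonoOn_tan.monotoneOn ⟨by linarith, hy⟩ ⟨by linarith, hx⟩ hyx
  have h2 : 0 < tan y := tan_pos_of_pos_of_lt_pi_div_two hy0 hy
  nlinarith

lemma tan_div_le_tan_div {x y : ℝ} (hx : 0 < x) (hxy : x ≤ y) (hy : y < π / 2) :
    y * tan x ≤ x * tan y := by
  have key : AntitoneOn (fun x : ℝ => x * cos x / sin x) (Set.Ioo 0 (π / 2)) := by
    have hd : ∀ u ∈ Set.Ioo (0 : ℝ) (π / 2), HasDerivAt (fun x : ℝ => x * cos x / sin x)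
        (((1 * cos u + u * (-sin u)) * sin u - u * cos u * cos u) / sin u ^ 2) u := by
      intro u hu
      have hs : sin u ≠ 0 := (sin_pos_of_pos_of_lt_pi hu.1 (by linarith [hu.2])).ne'
      exact ((hasDerivAt_id' u).mul (hasDerivAt_cos u)).div (hasDerivAt_sin u) hs
    refine antitoneOn_of_deriv_nonpos (convex_Ioo _ _)
      (fun u hu => (hd u hu).continuousAt.continuousWithinAt)
      (fun u hu => (hd u (interior_subset hu)).differentiableAt.differentiableWithinAt) ?_
    intro u hu
    rw [interior_Ioo] at hu
    rw [(hd u hu).deriv]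
    refine div_nonpos_of_nonpos_of_nonneg ?_ (sq_nonneg _)
    have h1 : sin u ≤ u := sin_le hu.1.le
    have h2 : 0 < sin u := sin_pos_of_pos_of_lt_pi hu.1 (by linarith [hu.2])
    have h3 : 0 < cos u := cos_pos_of_mem_Ioo ⟨by linarith [hu.1, pi_pos], hu.2⟩
    nlinarith [sin_sq_add_cos_sq u, cos_le_one u]
  have h := key ⟨hx, by linarith⟩ ⟨by linarith, hy⟩ hxy
  have hsx : 0 < sin x := sin_pos_of_pos_of_lt_pi hx (by linarith [pi_pos])
  have hsy : 0 < sin y := sin_pos_of_pos_of_lt_pi (by linarith) (by linarith [pi_pos])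
  have hcx : 0 < cos x := cos_pos_of_mem_Ioo ⟨by linarith [pi_pos], by linarith⟩
  have hcy : 0 < cos y := cos_pos_of_mem_Ioo ⟨by linarith [pi_pos], by linarith⟩
  simp only [div_le_div_iff₀ hsy hsx] at h
  rw [tan_eq_sin_div_cos, tan_eq_sin_div_cos, ← mul_div_assoc, ← mul_div_assoc,
    div_le_div_iff₀ hcx hcy]
  linarith

/-- `x ↦ cot x / x` is a convex function of `log x` on `(0, π/2)`. -/
lemma convexOn_cot_exp_div_exp :
    ConvexOn ℝ (Set.Iio (log (π / 2)))
      (fun v : ℝ => cos (exp v) / (exp v * sin (exp v))) := by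
  have hmem : ∀ v ∈ Set.Iio (log (π / 2)), exp v < π / 2 := fun v hv =>
    (lt_log_iff_exp_lt (by positivity)).1 hv
  have hsin : ∀ v ∈ Set.Iio (log (π / 2)), 0 < sin (exp v) := fun v hv =>
    sin_pos_of_pos_of_lt_pi (exp_pos v) (by linarith [hmem v hv, pi_pos])
  have hcos : ∀ v ∈ Set.Iio (log (π / 2)), 0 < cos (exp v) := fun v hv =>
    cos_pos_of_mem_Ioo ⟨by linarith [exp_pos v, pi_pos], hmem v hv⟩
  have hd : ∀ v ∈ Set.Iio (log (π / 2)),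
      HasDerivAt (fun v : ℝ => cos (exp v) / (exp v * sin (exp v)))
        (-(1 / sin (exp v) ^ 2 + cos (exp v) / (exp v * sin (exp v)))) v := by
    intro v hv
    have hs := hsin v hv
    have he := exp_pos v
    have h := ((hasDerivAt_exp v).cos).div ((hasDerivAt_exp v).mul (hasDerivAt_exp v).sin)
      (mul_pos he hs).ne'
    refine h.congr_deriv ?_
    simp only [Pi.mul_apply]
    field_simp
    linear_combination (-exp v) * sin_sq_add_cos_sq (exp v)
  refine MonotoneOn.convexOn_of_deriv (convex_Iio _)
    (fun u hu => (hd u hu).continuousAt.continuousWithinAt)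
    (fun u hu => (hd u (interior_subset hu)).differentiableAt.differentiableWithinAt) ?_
  rw [interior_Iio]
  intro u hu v hv huv
  rw [(hd u hu).deriv, (hd v hv).deriv, neg_le_neg_iff]
  have he : exp u ≤ exp v := exp_le_exp.2 huv
  have h1 : sin (exp u) ≤ sin (exp v) :=
    sin_le_sin_of_le_of_le_pi_div_two (by linarith [exp_pos u, pi_pos]) (hmem v hv).le he
  have h2 : cos (exp v) ≤ cos (exp u) :=
    cos_le_cos_of_nonneg_of_le_pi (exp_pos u).le (by linarith [hmem v hv, pi_pos]) he
  have := hsin u hu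
  have := hcos u hu
  have := exp_pos u
  gcongr

lemma two_div_sqrt_mul_tan_le {x y : ℝ} (hx : 0 < x) (hx' : x < π / 2) (hy : 0 < y)
    (hy' : y < π / 2) :
    2 / (√(x * y) * tan √(x * y)) ≤ 1 / (x * tan x) + 1 / (y * tan y) := by
  have h := convexOn_cot_exp_div_exp.2 (log_lt_log hx hx') (log_lt_log hy hy')
    (by norm_num : (0 : ℝ) ≤ 1 / 2) (by norm_num : (0 : ℝ) ≤ 1 / 2) (by norm_num)
  have he : exp ((1 / 2 : ℝ) • log x + (1 / 2 : ℝ) • log y) = √(x * y) := by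
    rw [sqrt_eq_rpow, rpow_def_of_pos (by positivity), log_mul hx.ne' hy.ne']
    congr 1
    simp only [smul_eq_mul]
    ring
  have hc : ∀ u : ℝ, cos u / (u * sin u) = 1 / (u * tan u) := by
    intro u
    rw [tan_eq_sin_div_cos, ← mul_div_assoc, one_div_div]
  simp only [he] at h
  simp only [exp_log hx, exp_log hy, hc, smul_eq_mul] at h
  have h2 : 2 / (√(x * y) * tan √(x * y)) = 2 * (1 / (√(x * y) * tan √(x * y))) := by ring
  linarith

lemma two_mul_sq_mul_sq_lt {t w y z : ℝ} (ht : 1 ≤ 2 * t) (hw : 0 < w) (hw' : w < π / 2)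
    (hy : 0 < y) (hy' : y < π / 2) (hz : 0 < z) (hz' : z < π / 2)
    (hwy : 2 * t * (w * tan w) < y * tan y) (hwz : t * (z * tan z) = w * tan w) :
    2 * t ^ 2 * w ^ 2 < y ^ 2 + t ^ 4 * z ^ 2 := by
  have htw := tan_pos_of_pos_of_lt_pi_div_two hw hw'
  have hty := tan_pos_of_pos_of_lt_pi_div_two hy hy'
  have htz := tan_pos_of_pos_of_lt_pi_div_two hz hz'
  have hpw := mul_pos hw htw
  have hpy := mul_pos hy hty
  have hpz := mul_pos hz htz
  have ht0 : 0 < t := by linarith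
  have hwy' : w < y := lt_of_mul_tan_lt_mul_tan hy hw' hy' (by nlinarith)
  have hsq : w ^ 2 < y ^ 2 := by gcongr
  rcases le_total t 1 with h1 | h1
  · have hwz' : w ≤ z := by
      by_contra! hlt
      have : tan z < tan w := tan_lt_tan_of_lt_of_lt_pi_div_two (by linarith) hw' hlt
      nlinarith
    have : w ^ 2 ≤ z ^ 2 := by gcongr
    nlinarith [mul_le_mul_of_nonneg_left this (by positivity : (0 : ℝ) ≤ t ^ 4),
      mul_nonneg (sq_nonneg w) (sq_nonneg (t ^ 2 - 1))]
  rcases le_total t (17 / 10) with h2 | h2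
  · have hm : 0 < √(y * z) := by positivity
    have hyz : √(y * z) ^ 2 = y * z := sq_sqrt (by positivity)
    have hm' : √(y * z) < π / 2 := by
      rw [sqrt_lt' (by positivity)]
      nlinarith
    have hpm := mul_pos hm (tan_pos_of_pos_of_lt_pi_div_two hm hm')
    have hconv := two_div_sqrt_mul_tan_le hy hy' hz hz'
    have hY : 1 / (y * tan y) < 1 / (2 * t) * (1 / (w * tan w)) := by
      rw [one_div_mul_one_div]
      exact one_div_lt_one_div_of_lt (by positivity) hwy
    have hZ : 1 / (z * tan z) = t * (1 / (w * tan w)) := by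
      rw [← hwz]
      field_simp
    have ht2 : 1 / (2 * t) + t ≤ 2 := by
      rw [← sub_nonneg]
      have : 2 - (1 / (2 * t) + t) = (4 * t - 1 - 2 * t ^ 2) / (2 * t) := by
        field_simp
        ring
      rw [this]
      apply div_nonneg _ (by positivity)
      nlinarith
    have hlt : 2 / (√(y * z) * tan √(y * z)) < 2 / (w * tan w) := by
      have hW : 0 < 1 / (w * tan w) := by positivity
      have h3 : 2 / (w * tan w) = 2 * (1 / (w * tan w)) := by ring
      nlinarith
    rw [div_lt_div_iff_of_pos_left (by norm_num) hpm hpw] at hlt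
    have hlt' : w < √(y * z) := lt_of_mul_tan_lt_mul_tan hm hw' hm' hlt
    have : w ^ 2 < y * z := by
      rw [← hyz]
      gcongr
    nlinarith [sq_nonneg (y - t ^ 2 * z),
      mul_lt_mul_of_pos_left this (by positivity : (0 : ℝ) < t ^ 2)]
  · have hzw : z ≤ w := by
      by_contra! hlt
      have : tan w < tan z := tan_lt_tan_of_lt_of_lt_pi_div_two (by linarith) hz' hlt
      nlinarith
    have h3 := tan_div_le_tan_div hz hzw hw'
    have h4 : w ^ 2 ≤ t * z ^ 2 := by
      have : w ^ 2 * tan z ≤ t * z ^ 2 * tan z := by nlinarith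
      exact le_of_mul_le_mul_right this htz
    have h5 : t ^ 3 * w ^ 2 ≤ t ^ 4 * z ^ 2 := by
      nlinarith [mul_le_mul_of_nonneg_left h4 (by positivity : (0 : ℝ) ≤ t ^ 3)]
    have h6 : 0 ≤ 1 + t ^ 3 - 2 * t ^ 2 := by nlinarith [mul_nonneg ht0.le (sq_nonneg (t - 1))]
    nlinarith [mul_nonneg h6 (sq_nonneg w)]

/-- Half-angle bound for the function in the equation of the second Robin eigenvalue. -/
lemma neg_two_mul_cot_two_mul_lt_mul_tan {y : ℝ} (hy : 0 < y) (hy' : y < π / 2) :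
    -(2 * y * cot (2 * y)) < y * tan y := by
  have hs : 0 < sin y := sin_pos_of_pos_of_lt_pi hy (by linarith)
  have hc : 0 < cos y := cos_pos_of_mem_Ioo ⟨by linarith, hy'⟩
  have h : -(2 * y * cot (2 * y)) = y * tan y - y * (cos y / sin y) := by
    rw [cot_eq_cos_div_sin, tan_eq_sin_div_cos, cos_two_mul', sin_two_mul]
    field_simp
    ring
  rw [h]
  have : 0 < y * (cos y / sin y) := by positivity
  linarith

/-- Let `lam1 a α = λ₁(a,α)` be the first Robin eigenvalue of an interval of length `a > 0`
with parameter `α > 0` (the unique `λ ∈ (0, π²/a²)` with `α = √λ · tan(a√λ/2)`), and let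
`lam2 a α = λ₂(a,α)` be the second one (the unique `λ ∈ (π²/a², 4π²/a²)` with
`α = −√λ · cot(a√λ/2)`). Fix `A > 0` and `α > 0`. For every `a ≥ 1`, the `(2,1)`-mode
eigenvalue of the rectangle with side lengths `√A·a` and `√A/a` satisfies
`λ₂(√A·a, α) + λ₁(√A/a, α) > 2·λ₁(√(A/2), α)`. -/
theorem two_one_mode_gt_two_squares (lam1 lam2 : ℝ → ℝ → ℝ)
    (hlam1 : ∀ a α : ℝ, 0 < a → 0 < α → lam1 a α ∈ Set.Ioo 0 (π ^ 2 / a ^ 2) ∧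
      α = Real.sqrt (lam1 a α) * Real.tan (a * Real.sqrt (lam1 a α) / 2))
    (hlam2 : ∀ a α : ℝ, 0 < a → 0 < α →
      lam2 a α ∈ Set.Ioo (π ^ 2 / a ^ 2) (4 * π ^ 2 / a ^ 2) ∧
      α = -(Real.sqrt (lam2 a α) * Real.cot (a * Real.sqrt (lam2 a α) / 2)))
    (A α : ℝ) (hA : 0 < A) (hα : 0 < α) (a : ℝ) (ha : 1 ≤ a) :
    2 * lam1 (Real.sqrt (A / 2)) α <
      lam2 (Real.sqrt A * a) α + lam1 (Real.sqrt A / a) α := by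
  have hfirst : ∀ l : ℝ, 0 < l → ∃ x, 0 < x ∧ x < π / 2 ∧ x * tan x = α * l / 2 ∧
      l ^ 2 * lam1 l α = 4 * x ^ 2 := by
    intro l hl
    obtain ⟨⟨h0, h1⟩, h2⟩ := hlam1 l α hl hα
    set q := √(lam1 l α) with hq
    have hq0 : 0 < q := sqrt_pos.2 h0
    have hqq : q ^ 2 = lam1 l α := sq_sqrt h0.le
    have hlt : l * q < π := by
      refine lt_of_pow_lt_pow_left₀ 2 pi_pos.le ?_
      rw [lt_div_iff₀ (by positivity), ← hqq] at h1
      linarith [mul_pow l q 2]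
    refine ⟨l * q / 2, by positivity, by linarith, ?_, ?_⟩
    · rw [h2]
      ring
    · rw [← hqq]
      ring
  have hsecond : ∀ l : ℝ, 0 < l → ∃ y, 0 < y ∧ y < π / 2 ∧ α * l / 2 < y * tan y ∧
      l ^ 2 * lam2 l α = 16 * y ^ 2 := by
    intro l hl
    obtain ⟨⟨h0, h1⟩, h2⟩ := hlam2 l α hl hα
    have h0 : 0 < lam2 l α := lt_trans (by positivity) h0
    set q := √(lam2 l α) with hq
    have hq0 : 0 < q := sqrt_pos.2 h0
    have hqq : q ^ 2 = lam2 l α := sq_sqrt h0.le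
    have hlt : l * q < 2 * π := by
      refine lt_of_pow_lt_pow_left₀ 2 (by positivity) ?_
      rw [lt_div_iff₀ (by positivity), ← hqq] at h1
      linarith [mul_pow l q 2, mul_pow 2 π 2]
    have hy : l * q / 4 < π / 2 := by linarith
    refine ⟨l * q / 4, by positivity, hy, ?_, ?_⟩
    · have h := neg_two_mul_cot_two_mul_lt_mul_tan (by positivity : 0 < l * q / 4) hy
      rw [show 2 * (l * q / 4) = l * q / 2 by ring] at h
      refine lt_of_eq_of_lt ?_ h
      conv_lhs => rw [h2]
      ring
    · rw [← hqq]
      ring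
  have ha0 : 0 < a := by linarith
  have hsA : 0 < √A := sqrt_pos.2 hA
  have hs2 : 0 < √(2 : ℝ) := by positivity
  have hAA : √A ^ 2 = A := sq_sqrt hA.le
  have h22 : √(2 : ℝ) ^ 2 = 2 := sq_sqrt (by norm_num)
  obtain ⟨w, hw, hw', hwt, hwl⟩ := hfirst √(A / 2) (by positivity)
  obtain ⟨z, hz, hz', hzt, hzl⟩ := hfirst (√A / a) (by positivity)
  obtain ⟨y, hy, hy', hyt, hyl⟩ := hsecond (√A * a) (by positivity)
  rw [sq_sqrt (by positivity)] at hwl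
  rw [sqrt_div hA.le] at hwt
  rw [div_pow, hAA] at hzl
  rw [mul_pow, hAA] at hyl
  have key := two_mul_sq_mul_sq_lt (t := a / √2) (w := w) (y := y) (z := z) (by
      have : √(2 : ℝ) ≤ 2 := by nlinarith
      rw [← mul_div_assoc, le_div_iff₀ hs2]
      linarith) hw hw' hy hy' hz hz' (by
      refine lt_of_eq_of_lt ?_ hyt
      rw [hwt]
      field_simp
      rw [h22]) (by
      rw [hwt, hzt]
      field_simp)
  have ht2 : (a / √2) ^ 2 = a ^ 2 / 2 := by rw [div_pow, h22]
  have ht4 : (a / √2) ^ 4 = a ^ 4 / 4 := by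
    rw [show (a / √2) ^ 4 = ((a / √2) ^ 2) ^ 2 by ring, ht2]
    ring
  rw [ht2, ht4] at key
  have hzl' : A * lam1 (√A / a) α = 4 * z ^ 2 * a ^ 2 := by
    field_simp at hzl
    linarith
  refine lt_of_mul_lt_mul_left ?_ (by positivity : 0 ≤ A * a ^ 2)
  have e1 : A * a ^ 2 * (2 * lam1 √(A / 2) α) = 16 * a ^ 2 * w ^ 2 := by
    linear_combination 4 * a ^ 2 * hwl
  have e2 : A * a ^ 2 * (lam2 (√A * a) α + lam1 (√A / a) α) =
      16 * y ^ 2 + 4 * a ^ 4 * z ^ 2 := by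
    linear_combination hyl + a ^ 2 * hzl'
  rw [e1, e2]
  linarith
end

section
/- Fix a natural number k ≥ 1, a total area A > 0 and a boundary parameter α > 0, and let Λ := 2·λ₁(√(A/k), α) (the k-th Robin eigenvalue of the disjoint union of k equal squares of total area A). Then 4απ²k/(√A·(π²·√k + 2α·√A)) ≤ Λ ≤ (π²√k/((π² − 8)·A)) · (π²√k + 2α√A − √(64α·√k·√A + (π²√k − 2α√A)²)). -/
open Real

/-- The Mittag-Leffler expansion of the cotangent on `(0, 1)`. -/
theorem hasSum_pi_mul_cot_sub {x : ℝ} (h0 : 0 < x) (h1 : x < 1) :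
    HasSum (fun n : ℕ => 2 * x / (x ^ 2 - ((n : ℝ) + 1) ^ 2)) (π * cot (π * x) - 1 / x) := by
  have hx : (x : ℂ) ∈ Complex.integerComplement := by
    rintro ⟨n, hn⟩
    have hn' : (n : ℝ) = x := by exact_mod_cast hn
    have hpos : (0 : ℤ) < n := by exact_mod_cast hn'.symm ▸ h0
    have hlt : n < (1 : ℤ) := by exact_mod_cast hn'.symm ▸ h1
    omega
  have hs := (summable_cotTerm hx).hasSum
  have ht : ∑' n : ℕ, cotTerm (x : ℂ) n = π * Complex.cot (π * x) - 1 / x :=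
    (cot_series_rep' hx).symm
  rw [ht] at hs
  rw [← Complex.hasSum_ofReal]
  convert! hs using 1
  · ext n
    rw [cotTerm_identity hx]
    push_cast
    rw [mul_one_div]
    congr 1
    ring
  · push_cast
    rfl

theorem hasSum_one_div_odd_sq :
    HasSum (fun n : ℕ => 1 / (2 * (n : ℝ) + 1) ^ 2) (π ^ 2 / 8) := by
  have hz := hasSum_zeta_two
  have he : HasSum (fun n : ℕ => 1 / ((2 * n : ℕ) : ℝ) ^ 2) (π ^ 2 / 6 / 4) := by
    refine (hz.div_const 4).congr_fun fun n => ?_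
    push_cast
    rw [mul_pow, div_div, mul_comm ((n : ℝ) ^ 2)]
    norm_num
  have ho : Summable (fun n : ℕ => 1 / ((2 * n + 1 : ℕ) : ℝ) ^ 2) :=
    hz.summable.comp_injective (i := fun n : ℕ => 2 * n + 1) fun a b h => by
      simp only at h
      omega
  have hu := (HasSum.even_add_odd (f := fun n : ℕ => 1 / (n : ℝ) ^ 2) he ho.hasSum).unique hz
  have hv := ho.hasSum
  rw [show ∑' n : ℕ, 1 / ((2 * n + 1 : ℕ) : ℝ) ^ 2 = π ^ 2 / 8 by linarith] at hv
  exact_mod_cast hv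

/-- The Mittag-Leffler expansion of the tangent on `(0, π / 2)`. -/
theorem hasSum_pi_mul_tan {x : ℝ} (h0 : 0 < x) (h1 : x < 1 / 2) :
    HasSum (fun n : ℕ => 8 * x / ((2 * (n : ℝ) + 1) ^ 2 - 4 * x ^ 2)) (π * tan (π * x)) := by
  have hS := hasSum_pi_mul_cot_sub h0 (by linarith)
  have hD := hasSum_pi_mul_cot_sub (x := 2 * x) (by linarith) (by linarith)
  set f : ℕ → ℝ := fun n => 2 * (2 * x) / ((2 * x) ^ 2 - ((n : ℝ) + 1) ^ 2) with hf
  have ho : HasSum (fun n : ℕ => f (2 * n + 1)) ((π * cot (π * x) - 1 / x) / 2) := by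
    refine (hS.div_const 2).congr_fun fun n => ?_
    have hne : x ^ 2 - ((n : ℝ) + 1) ^ 2 ≠ 0 := by nlinarith [(n.cast_nonneg : (0 : ℝ) ≤ n)]
    have hne' : (2 * x) ^ 2 - (((2 * n + 1 : ℕ) : ℝ) + 1) ^ 2 ≠ 0 := by
      push_cast
      contrapose! hne
      linarith
    simp only [hf]
    rw [div_div, div_eq_div_iff hne' (by positivity)]
    push_cast
    ring
  have he : Summable (fun n : ℕ => f (2 * n)) :=
    hD.summable.comp_injective (i := fun n : ℕ => 2 * n) fun a b h => by
      simp only at h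
      omega
  have hu := (HasSum.even_add_odd he.hasSum ho).unique hD
  have hxpi : π * x < π / 2 := by nlinarith [pi_pos]
  have hc : cos (π * x) ≠ 0 :=
    (cos_pos_of_mem_Ioo ⟨by nlinarith [mul_pos pi_pos h0, pi_pos], hxpi⟩).ne'
  have hsn : sin (π * x) ≠ 0 := (sin_pos_of_pos_of_lt_pi (by positivity) (by linarith [pi_pos])).ne'
  have htan : tan (π * x) = cot (π * x) - 2 * cot (π * (2 * x)) := by
    rw [show π * (2 * x) = 2 * (π * x) by ring, cot_eq_cos_div_sin, cot_eq_cos_div_sin,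
      tan_eq_sin_div_cos, sin_two_mul, cos_two_mul']
    field_simp
    ring
  have hv : -2 * ∑' n : ℕ, f (2 * n) = π * tan (π * x) := by
    have hxx : 1 / (2 * x) = 1 / x / 2 := by field_simp
    rw [hxx] at hu
    rw [htan]
    linarith
  rw [← hv]
  refine (he.hasSum.mul_left (-2)).congr_fun fun n => ?_
  simp only [hf]
  push_cast
  rw [show (2 * (n : ℝ) + 1) ^ 2 - 4 * x ^ 2 = -((2 * x) ^ 2 - (2 * n + 1) ^ 2) by ring, div_neg]
  ring

/-- The Becker–Stark upper bound for the tangent. -/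
theorem tan_mul_le {y : ℝ} (h0 : 0 < y) (h1 : y < π / 2) :
    tan y * (π ^ 2 - 4 * y ^ 2) ≤ π ^ 2 * y := by
  obtain ⟨x, rfl⟩ : ∃ x, y = π * x := ⟨y / π, by field_simp⟩
  have hx0 : 0 < x := pos_of_mul_pos_right h0 pi_pos.le
  have hx1 : x < 1 / 2 := by nlinarith [pi_pos]
  have hw : 0 < 1 - 4 * x ^ 2 := by nlinarith
  have hle := hasSum_le (fun n => ?_) ((hasSum_pi_mul_tan hx0 hx1).mul_right (1 - 4 * x ^ 2))
    (hasSum_one_div_odd_sq.mul_left (8 * x))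
  · nlinarith [mul_le_mul_of_nonneg_left hle pi_pos.le]
  · have hn : (0 : ℝ) ≤ n := n.cast_nonneg
    have hM : 1 ≤ (2 * (n : ℝ) + 1) ^ 2 := by nlinarith
    rw [div_mul_eq_mul_div, mul_one_div, div_le_div_iff₀ (by linarith) (by positivity),
      mul_assoc (8 * x)]
    gcongr
    nlinarith [mul_nonneg (sq_nonneg x) (sub_nonneg.2 hM)]

/-- A refined lower bound for the tangent, sharp to leading order at both ends of `(0, π / 2)`. -/
theorem le_tan_mul {y : ℝ} (h0 : 0 < y) (h1 : y < π / 2) :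
    y * (π ^ 2 - 4 * y ^ 2 * (π ^ 2 - 8) / π ^ 2) ≤ tan y * (π ^ 2 - 4 * y ^ 2) := by
  obtain ⟨x, rfl⟩ : ∃ x, y = π * x := ⟨y / π, by field_simp⟩
  have hx0 : 0 < x := pos_of_mul_pos_right h0 pi_pos.le
  have hx1 : x < 1 / 2 := by nlinarith [pi_pos]
  have hw : 0 < 1 - 4 * x ^ 2 := by nlinarith
  have hle := hasSum_le (fun n => ?_)
    ((hasSum_one_div_odd_sq.mul_left (8 * x * (1 - 4 * x ^ 2))).add
      (hasSum_ite_eq 0 (8 * x * (4 * x ^ 2))))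
    ((hasSum_pi_mul_tan hx0 hx1).mul_right (1 - 4 * x ^ 2))
  · have hl := mul_le_mul_of_nonneg_left hle pi_pos.le
    have heq : 4 * (π * x) ^ 2 * (π ^ 2 - 8) / π ^ 2 = 4 * x ^ 2 * (π ^ 2 - 8) := by
      field_simp
    rw [heq]
    linarith
  · rcases n with _ | n
    · simp only [Nat.cast_zero, if_true]
      rw [div_mul_eq_mul_div, le_div_iff₀ (by linarith)]
      apply le_of_eq
      ring
    · have hM : 1 ≤ (2 * ((n + 1 : ℕ) : ℝ) + 1) ^ 2 := by
        nlinarith [((n + 1).cast_nonneg : (0 : ℝ) ≤ ((n + 1 : ℕ) : ℝ))]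
      rw [if_neg n.succ_ne_zero, add_zero, mul_one_div, div_mul_eq_mul_div]
      have : 0 < (2 * ((n + 1 : ℕ) : ℝ) + 1) ^ 2 - 4 * x ^ 2 := by linarith
      gcongr
      nlinarith [sq_nonneg x]

/-- The quadratic inequality for the frequency behind the upper eigenvalue bound. -/
theorem sqrt_le_of_tan {y : ℝ} (h0 : 0 < y) (h1 : y < π / 2) :
    √(128 * (y * tan y) + (π ^ 2 - 4 * (y * tan y)) ^ 2) ≤
      π ^ 2 + 4 * (y * tan y) - 8 * y ^ 2 * (π ^ 2 - 8) / π ^ 2 := by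
  have hpi := pi_gt_three
  have hpi' := pi_lt_d2
  have ht := mul_le_mul_of_nonneg_left (le_tan_mul h0 h1) h0.le
  have hT : 0 < tan y := tan_pos_of_pos_of_lt_pi_div_two h0 h1
  have hb : 0 < y * tan y := mul_pos h0 hT
  set b := y * tan y with hb'
  have hc : 0 < π ^ 2 - 8 := by nlinarith
  set q := y ^ 2 * (π ^ 2 - 8) / π ^ 2 with hq
  have hqm : q * π ^ 2 = y ^ 2 * (π ^ 2 - 8) := by rw [hq]; field_simp
  have e8 : 8 * y ^ 2 * (π ^ 2 - 8) / π ^ 2 = 8 * q := by rw [hq]; ring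
  have e4 : 4 * y ^ 2 * (π ^ 2 - 8) / π ^ 2 = 4 * q := by rw [hq]; ring
  rw [e4] at ht
  rw [e8]
  have hy : 4 * y ^ 2 < π ^ 2 := by nlinarith
  have hq4 : 4 * q < π ^ 2 - 8 := by
    have : 4 * q * π ^ 2 < (π ^ 2 - 8) * π ^ 2 := by nlinarith
    exact lt_of_mul_lt_mul_right this (by positivity)
  apply sqrt_le_iff.2
  constructor
  · nlinarith
  · have key : y ^ 2 * (π ^ 2 - 4 * q) ≤ b * (π ^ 2 - 4 * y ^ 2) := by linarith
    have h2 := mul_le_mul_of_nonneg_left key hc.le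
    have h3 : π ^ 2 * (q * (π ^ 2 - 4 * q)) ≤ π ^ 2 * (b * (π ^ 2 - 8 - 4 * q)) := by
      linear_combination h2 + (π ^ 2 - 4 * q + 4 * b) * hqm
    have h4 := le_of_mul_le_mul_left h3 (by positivity)
    linear_combination 16 * h4

/-- Let `lam1 a α = λ₁(a,α)` denote the first Robin eigenvalue of an interval of length
`a > 0` with boundary parameter `α > 0`, i.e. the unique `λ ∈ (0, π²/a²)` with
`α = √λ · tan(a√λ/2)`. Fix `k ≥ 1`, a total area `A > 0` and `α > 0`, and let
`Λ := 2·λ₁(√(A/k), α)` be the `k`-th Robin eigenvalue of the disjoint union of `k` equal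
squares of total area `A`. Then
`4απ²k/(√A·(π²·√k + 2α·√A)) ≤ Λ ≤ (π²√k/((π² − 8)·A))·(π²√k + 2α√A − √(64α·√k·√A + (π²√k − 2α√A)²))`. -/
theorem k_equal_squares_eigenvalue_bounds (lam1 : ℝ → ℝ → ℝ)
    (hlam : ∀ a α : ℝ, 0 < a → 0 < α → lam1 a α ∈ Set.Ioo 0 (π ^ 2 / a ^ 2) ∧
      α = Real.sqrt (lam1 a α) * Real.tan (a * Real.sqrt (lam1 a α) / 2))
    (k : ℕ) (hk : 1 ≤ k) (A α : ℝ) (hA : 0 < A) (hα : 0 < α) :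
    4 * α * π ^ 2 * k / (Real.sqrt A * (π ^ 2 * Real.sqrt k + 2 * α * Real.sqrt A)) ≤
        2 * lam1 (Real.sqrt (A / k)) α ∧
      2 * lam1 (Real.sqrt (A / k)) α ≤
        π ^ 2 * Real.sqrt k / ((π ^ 2 - 8) * A) *
          (π ^ 2 * Real.sqrt k + 2 * α * Real.sqrt A -
            Real.sqrt (64 * α * Real.sqrt k * Real.sqrt A +
              (π ^ 2 * Real.sqrt k - 2 * α * Real.sqrt A) ^ 2)) := by
  have hk0 : (0 : ℝ) < k := by exact_mod_cast hk
  have hs : 0 < √(k : ℝ) := sqrt_pos.2 hk0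
  have ht : 0 < √A := sqrt_pos.2 hA
  have hss : √(k : ℝ) ^ 2 = k := sq_sqrt hk0.le
  have htt : √A ^ 2 = A := sq_sqrt hA.le
  have ha : √(A / k) = √A / √(k : ℝ) := sqrt_div hA.le _
  rw [ha]
  obtain ⟨⟨hl0, hl1⟩, hl⟩ := hlam (√A / √(k : ℝ)) α (by positivity) hα
  set lam := lam1 (√A / √(k : ℝ)) α
  set s := √(k : ℝ)
  set t := √A
  set y := t / s * √lam / 2 with hy
  have hr : 0 < √lam := sqrt_pos.2 hl0
  have hrr : √lam ^ 2 = lam := sq_sqrt hl0.le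
  have hy0 : 0 < y := by positivity
  have hy1 : y < π / 2 := by
    have : √lam < π / (t / s) := by
      rw [sqrt_lt' (by positivity), div_pow]
      exact hl1
    rw [lt_div_iff₀ (by positivity)] at this
    rw [hy]
    linarith
  have hlam_eq : lam = 4 * y ^ 2 * s ^ 2 / t ^ 2 := by
    rw [← hrr, hy]
    field_simp
    norm_num
  have hb : 2 * (y * tan y) * s = α * t := by
    rw [hl]
    simp only [hy]
    field_simp
  have hT : 0 < tan y := tan_pos_of_pos_of_lt_pi_div_two hy0 hy1
  have hbp : 0 < y * tan y := mul_pos hy0 hT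
  have hα' : α = 2 * (y * tan y) * s / t := by rw [hb]; field_simp
  rw [← hss, ← htt, hlam_eq]
  constructor
  · have hup := mul_le_mul_of_nonneg_left (tan_mul_le hy0 hy1) hy0.le
    set b := y * tan y
    have hlhs : 4 * α * π ^ 2 * s ^ 2 / (t * (π ^ 2 * s + 2 * α * t)) =
        8 * (b * π ^ 2 / (π ^ 2 + 4 * b)) * s ^ 2 / t ^ 2 := by
      rw [hα']
      field_simp
      ring
    rw [hlhs, show 2 * (4 * y ^ 2 * s ^ 2 / t ^ 2) = 8 * y ^ 2 * s ^ 2 / t ^ 2 by ring]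
    gcongr
    rw [div_le_iff₀ (by positivity)]
    linarith
  · have hsq := sqrt_le_of_tan hy0 hy1
    set b := y * tan y
    have hc : 0 < π ^ 2 - 8 := by nlinarith [pi_gt_three]
    have hroot : √(64 * α * s * t + (π ^ 2 * s - 2 * α * t) ^ 2) =
        s * √(128 * b + (π ^ 2 - 4 * b) ^ 2) := by
      rw [show 64 * α * s * t + (π ^ 2 * s - 2 * α * t) ^ 2 =
        s ^ 2 * (128 * b + (π ^ 2 - 4 * b) ^ 2) by
          rw [mul_assoc 2 α t, ← hb]
          linear_combination (-64 * s) * hb, sqrt_mul (by positivity), sqrt_sq hs.le]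
    rw [hroot]
    set R := √(128 * b + (π ^ 2 - 4 * b) ^ 2)
    have h8 : 8 * y ^ 2 * (π ^ 2 - 8) ≤ (π ^ 2 + 4 * b - R) * π ^ 2 := by
      rw [← div_le_iff₀ (by positivity)]
      linarith
    rw [show π ^ 2 * s + 2 * α * t - s * R = s * (π ^ 2 + 4 * b - R) by
      linear_combination (-2) * hb, div_mul_eq_mul_div, mul_div_assoc',
      div_le_div_iff₀ (by positivity) (by positivity)]
    have h9 := mul_le_mul_of_nonneg_left h8 (by positivity : 0 ≤ s ^ 2 * t ^ 2)
    linarith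
end
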